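/- arXiv:1702.08709 — 13 statements merged into one kernel-verified Lean document; each statement's English description precedes it below -/
import Mathlib

section
/- Let p1, p2, p3 be real numbers with p1 ≠ p2, p2 ≠ p3, p3 ≠ p1, and set s_ij := (p_i+p_j)/(p_i−p_j). Define the lattice Lagrangian ℒ(u,v,w; s) := u·(v−w) − (1/2)·s·(v−w)². Given reals u, u1, u2, u3, define u12 := u − s12·(u1−u2), u13 := u − s13·(u1−u3), u23 := u − s23·(u2−u3). Then the Lagrangian closure relation holds: ℒ(u1,u12,u13; s23) − ℒ(u,u2,u3; s23) + ℒ(u2,u23,u12; s31) − ℒ(u,u3,u1; s31) + ℒ(u3,u13,u23; s12) − ℒ(u,u1,u2; s12) = 0. -/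
/-- The lattice Lagrangian `ℒ(u,v,w; s) = u(v−w) − (1/2)s(v−w)²`. -/
noncomputable def latticeL (u v w s : ℝ) : ℝ := u * (v - w) - (1 / 2) * s * (v - w) ^ 2

/-- The quadratic relation among the coefficients `(p + q) / (p - q)` around a triangle. -/
theorem add_div_sub_cyclic_relation {K : Type*} [Field K] {p q r : K}
    (hpq : p ≠ q) (hqr : q ≠ r) (hrp : r ≠ p) :
    (p + q) / (p - q) * ((q + r) / (q - r)) + (q + r) / (q - r) * ((r + p) / (r - p))
      + (r + p) / (r - p) * ((p + q) / (p - q)) + 1 = 0 := by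
  have h₁ := sub_ne_zero.mpr hpq
  have h₂ := sub_ne_zero.mpr hqr
  have h₃ := sub_ne_zero.mpr hrp
  field_simp
  ring

/-- Lagrangian closure relation on the cube for the linearised lattice KdV equation. -/
theorem linearKdV_lagrangian_closure
    (p1 p2 p3 : ℝ) (h12 : p1 ≠ p2) (h23 : p2 ≠ p3) (h31 : p3 ≠ p1)
    (s12 s13 s23 s31 : ℝ)
    (hs12 : s12 = (p1 + p2) / (p1 - p2))
    (hs13 : s13 = (p1 + p3) / (p1 - p3))
    (hs23 : s23 = (p2 + p3) / (p2 - p3))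
    (hs31 : s31 = (p3 + p1) / (p3 - p1))
    (u u1 u2 u3 u12 u13 u23 : ℝ)
    (hu12 : u12 = u - s12 * (u1 - u2))
    (hu13 : u13 = u - s13 * (u1 - u3))
    (hu23 : u23 = u - s23 * (u2 - u3)) :
    latticeL u1 u12 u13 s23 - latticeL u u2 u3 s23
      + latticeL u2 u23 u12 s31 - latticeL u u3 u1 s31
      + latticeL u3 u13 u23 s12 - latticeL u u1 u2 s12 = 0 := by
  have hs : s13 = -s31 := by
    rw [hs13, hs31, ← neg_sub p1 p3, div_neg, neg_neg, add_comm]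
  have hrel : s12 * s23 + s23 * s31 + s31 * s12 + 1 = 0 := by
    rw [hs12, hs23, hs31]
    exact add_div_sub_cyclic_relation h12 h23 h31
  simp only [latticeL, hu12, hu13, hu23, hs]
  linear_combination
    (-(1 / 2) * (s12 * (u1 - u2) ^ 2 + s23 * (u2 - u3) ^ 2 + s31 * (u3 - u1) ^ 2)) * hrel
end

section
/- Let p, q be real numbers with p + q ≠ 0 and set s := (p−q)/(p+q). Suppose u0, u1, u2 : ℕ → ℝ satisfy, for all n: u2(n+1) = u0(n), u1(n+1) = u2(n) + s·(u0(n) − u1(n)), and u0(n+1) = u1(n) + s·(u1(n+1) − u2(n+1)). Then the reduced variable x(n) := u1(n) − u0(n) satisfies the discrete harmonic oscillator equation x(n+2) + 2b·x(n+1) + x(n) = 0 for all n, where 2b := 1 + 2s − s². -/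
/-- The period-3 periodic reduction of the linearised lattice KdV equation
yields the discrete harmonic oscillator for the reduced variable `x = u1 − u0`. -/
theorem periodic_reduction_discrete_harmonic_oscillator
    (p q : ℝ) (hpq : p + q ≠ 0) (s : ℝ) (hs : s = (p - q) / (p + q))
    (u0 u1 u2 : ℕ → ℝ)
    (h2 : ∀ n, u2 (n + 1) = u0 n)
    (h1 : ∀ n, u1 (n + 1) = u2 n + s * (u0 n - u1 n))
    (h0 : ∀ n, u0 (n + 1) = u1 n + s * (u1 (n + 1) - u2 (n + 1)))
    (b : ℝ) (hb : 2 * b = 1 + 2 * s - s ^ 2)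
    (x : ℕ → ℝ) (hx : ∀ n, x n = u1 n - u0 n) :
    ∀ n, x (n + 2) + 2 * b * x (n + 1) + x n = 0 := by
  intro n
  simp only [hb, hx, h0, h1, h2]
  ring
end

section
/- Let p, q, r be reals with p+q ≠ 0, p+r ≠ 0, q+r ≠ 0, and set s := (p−q)/(p+q), t := (p−r)/(p+r), t' := (q−r)/(q+r); assume 1 − t²·t' ≠ 0. Define the hat map H : ℝ³ → ℝ³ by H(u0,u1,u2) = (û0,û1,û2) where û2 = u0, û1 = u2 + s(u0−u1), û0 = u1 + s(û1−û2). Then: (i) for every (u0,u1,u2) ∈ ℝ³ there is a unique (ū0,ū1,ū2) ∈ ℝ³ satisfying ū0 = u1 + t(ū1−u0), ū1 = u2 + t(ū2−u1), ū2 = u0 + t'(ū0−u2), defining the bar map B : ℝ³ → ℝ³; and (ii) the two maps commute: H ∘ B = B ∘ H. -/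
/-- The hat map of the period-3 reduction: `(u0,u1,u2) ↦ (û0,û1,û2)` with
`û2 = u0`, `û1 = u2 + s(u0−u1)`, `û0 = u1 + s(û1−û2)`. -/
def hatMap (s : ℝ) : ℝ × ℝ × ℝ → ℝ × ℝ × ℝ :=
  fun u => (u.2.1 + s * ((u.2.2 + s * (u.1 - u.2.1)) - u.1),
            u.2.2 + s * (u.1 - u.2.1), u.1)

/-- The defining relation of the bar map with parameters `t`, `t'`:
`ū0 = u1 + t(ū1−u0)`, `ū1 = u2 + t(ū2−u1)`, `ū2 = u0 + t'(ū0−u2)`. -/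
def barRel (t t' : ℝ) (u v : ℝ × ℝ × ℝ) : Prop :=
  v.1 = u.2.1 + t * (v.2.1 - u.1) ∧
  v.2.1 = u.2.2 + t * (v.2.2 - u.2.1) ∧
  v.2.2 = u.1 + t' * (v.1 - u.2.2)

/-- The subtraction identity satisfied by the three lattice parameters. -/
theorem lattice_param_identity {p q r : ℝ} (hpq : p + q ≠ 0) (hpr : p + r ≠ 0)
    (hqr : q + r ≠ 0) :
    (p - q) / (p + q) * ((p - r) / (p + r)) * ((q - r) / (q + r)) =
      (p - q) / (p + q) - (p - r) / (p + r) + (q - r) / (q + r) := by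
  field_simp
  ring

theorem existsUnique_barRel {t t' : ℝ} (hden : 1 - t ^ 2 * t' ≠ 0) (u : ℝ × ℝ × ℝ) :
    ∃! v : ℝ × ℝ × ℝ, barRel t t' u v := by
  obtain ⟨a, b, c⟩ := u
  obtain ⟨x, hx⟩ : ∃ x, x * (1 - t ^ 2 * t') =
      (1 - t ^ 2) * b + t * (1 - t * t') * c + t * (t - 1) * a :=
    ⟨_, div_mul_cancel₀ _ hden⟩
  refine ⟨(x, c + t * (a + t' * (x - c) - b), a + t' * (x - c)), ⟨?_, rfl, rfl⟩, ?_⟩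
  · linear_combination hx
  · rintro ⟨x', y', z'⟩ ⟨h₁, h₂, h₃⟩
    simp only at h₁ h₂ h₃
    obtain rfl : x' = x := mul_right_cancel₀ hden (by
      linear_combination h₁ + t * h₂ + t ^ 2 * h₃ - hx)
    subst h₃
    simp [h₂]

/-- The hat map is a symmetry of the bar relation. -/
theorem barRel_hatMap {s t t' : ℝ} (hK : s * t * t' = s - t + t') {u v : ℝ × ℝ × ℝ}
    (h : barRel t t' u v) : barRel t t' (hatMap s u) (hatMap s v) := by
  obtain ⟨a, b, c⟩ := u
  obtain ⟨x, y, z⟩ := v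
  obtain ⟨h₁, h₂, h₃⟩ := h
  simp only at h₁ h₂ h₃
  simp only [barRel, hatMap]
  refine ⟨?_, ?_, ?_⟩ <;> grind

/-- The bar map is well defined and commutes with the hat map. -/
theorem hat_bar_maps_commute
    (p q r : ℝ) (hpq : p + q ≠ 0) (hpr : p + r ≠ 0) (hqr : q + r ≠ 0)
    (s t t' : ℝ) (hs : s = (p - q) / (p + q)) (ht : t = (p - r) / (p + r))
    (ht' : t' = (q - r) / (q + r)) (hden : 1 - t ^ 2 * t' ≠ 0) :
    (∀ u : ℝ × ℝ × ℝ, ∃! v : ℝ × ℝ × ℝ, barRel t t' u v) ∧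
    (∀ B : ℝ × ℝ × ℝ → ℝ × ℝ × ℝ, (∀ u, barRel t t' u (B u)) →
      hatMap s ∘ B = B ∘ hatMap s) := by
  have hK : s * t * t' = s - t + t' := by
    subst hs ht ht'
    exact lattice_param_identity hpq hpr hqr
  refine ⟨existsUnique_barRel hden, fun B hB => funext fun u => ?_⟩
  exact (existsUnique_barRel hden (hatMap s u)).unique
    (barRel_hatMap hK (hB u)) (hB (hatMap s u))
end

section
/- Let P, q, r be positive reals, Q := q², R := r², and let μ, ν be reals with cos μ = −(P−Q)/(P+Q), sin μ = 2q√P/(P+Q), cos ν = −(P−R)/(P+R), sin ν = 2r√P/(P+R). For reals c1, c2 define x(m,n) := c1·sin(μm+νn) + c2·cos(μm+νn) for m, n ∈ ℤ. Then x simultaneously satisfies: (i) x(m+1,n) + 2b·x(m,n) + x(m−1,n) = 0 with b := (P−Q)/(P+Q); (ii) x(m,n+1) + 2a·x(m,n) + x(m,n−1) = 0 with a := (P−R)/(P+R); and (iii) the corner equations ((P−Q)/q − (P−R)/r)·x(m,n) = ((P+R)/r)·x(m,n+1) − ((P+Q)/q)·x(m+1,n) and ((P−Q)/q − (P−R)/r)·x(m+1,n+1)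 = ((P+R)/r)·x(m+1,n) − ((P+Q)/q)·x(m,n+1), for all m, n ∈ ℤ. -/
/-- The harmonic oscillator equation for a sinusoid sampled with angular step `s`. -/
lemma sinusoid_add_step_add_sub_step (c1 c2 t s : ℝ) :
    (c1 * Real.sin (t + s) + c2 * Real.cos (t + s))
      - 2 * Real.cos s * (c1 * Real.sin t + c2 * Real.cos t)
      + (c1 * Real.sin (t - s) + c2 * Real.cos (t - s)) = 0 := by
  rw [Real.sin_add, Real.cos_add, Real.sin_sub, Real.cos_sub]
  ring

/-- Two sampled steps of a sinusoid, weighted so that their sine parts agree, combine to a multiple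
of the unshifted value. -/
lemma sinusoid_weighted_step_sub_step {A B s s' : ℝ} (h : A * Real.sin s = B * Real.sin s')
    (c1 c2 t : ℝ) :
    A * (c1 * Real.sin (t + s) + c2 * Real.cos (t + s))
      - B * (c1 * Real.sin (t + s') + c2 * Real.cos (t + s'))
      = (A * Real.cos s - B * Real.cos s') * (c1 * Real.sin t + c2 * Real.cos t) := by
  simp only [Real.sin_add, Real.cos_add]
  linear_combination (c1 * Real.cos t - c2 * Real.sin t) * h


/-- The joint solution `x(m,n) = c1 sin(μm+νn) + c2 cos(μm+νn)` of the two
commuting discrete harmonic oscillator flows satisfies both oscillator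
equations and the corner equations. -/
theorem joint_solution_commuting_flows_and_corner_equations
    (P q r Q R : ℝ) (hP : 0 < P) (hq : 0 < q) (hr : 0 < r)
    (hQ : Q = q ^ 2) (hR : R = r ^ 2)
    (μ ν : ℝ)
    (hcosμ : Real.cos μ = -((P - Q) / (P + Q)))
    (hsinμ : Real.sin μ = 2 * q * Real.sqrt P / (P + Q))
    (hcosν : Real.cos ν = -((P - R) / (P + R)))
    (hsinν : Real.sin ν = 2 * r * Real.sqrt P / (P + R))
    (c1 c2 : ℝ) (x : ℤ → ℤ → ℝ)
    (hx : ∀ m n : ℤ, x m n = c1 * Real.sin (μ * m + ν * n)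
        + c2 * Real.cos (μ * m + ν * n))
    (a b : ℝ) (ha : a = (P - R) / (P + R)) (hb : b = (P - Q) / (P + Q)) :
    ∀ m n : ℤ,
      (x (m + 1) n + 2 * b * x m n + x (m - 1) n = 0) ∧
      (x m (n + 1) + 2 * a * x m n + x m (n - 1) = 0) ∧
      (((P - Q) / q - (P - R) / r) * x m n
        = (P + R) / r * x m (n + 1) - (P + Q) / q * x (m + 1) n) ∧
      (((P - Q) / q - (P - R) / r) * x (m + 1) (n + 1)
        = (P + R) / r * x (m + 1) n - (P + Q) / q * x m (n + 1)) := by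
  have hPQ : P + Q ≠ 0 := by rw [hQ]; positivity
  have hPR : P + R ≠ 0 := by rw [hR]; positivity
  have hsin : (P + R) / r * Real.sin ν = (P + Q) / q * Real.sin μ := by
    rw [hsinμ, hsinν]
    field_simp
  have hcos : (P + R) / r * Real.cos ν - (P + Q) / q * Real.cos μ
      = (P - Q) / q - (P - R) / r := by
    rw [hcosμ, hcosν]
    field_simp
    ring
  have hsin_neg : (P + R) / r * Real.sin (-ν) = (P + Q) / q * Real.sin (-μ) := by
    rw [Real.sin_neg, Real.sin_neg]
    linear_combination -hsin
  intro m n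
  simp only [hx]
  push_cast
  refine ⟨?_, ?_, ?_, ?_⟩
  · have h := sinusoid_add_step_add_sub_step c1 c2 (μ * m + ν * n) μ
    rw [hcosμ, ← hb] at h
    convert h using 1
    ring_nf
  · have h := sinusoid_add_step_add_sub_step c1 c2 (μ * m + ν * n) ν
    rw [hcosν, ← ha] at h
    convert h using 1
    ring_nf
  · have h := sinusoid_weighted_step_sub_step hsin c1 c2 (μ * m + ν * n)
    rw [hcos] at h
    rw [← h]
    ring_nf
  · have h := sinusoid_weighted_step_sub_step hsin_neg c1 c2 (μ * (m + 1) + ν * (n + 1))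
    rw [Real.cos_neg, Real.cos_neg, hcos] at h
    rw [← h]
    ring_nf
end

section
/- Let s be a real parameter and define I1, I2 : ℝ⁴ → ℝ by I1(x1,x2,X1,X2) := x1·X1 − 2·x1·X2 + 2·x2·X1 − x2·X2 and I2(x1,x2,X1,X2) := (1 − (3/4)s²)·(x1² + x1·x2 + x2²) + X1² − X1·X2 + X2². Then I1 and I2 are in involution with respect to the canonical Poisson bracket: for all (x1,x2,X1,X2) ∈ ℝ⁴, (∂I1/∂x1)(∂I2/∂X1) + (∂I1/∂x2)(∂I2/∂X2) − (∂I1/∂X1)(∂I2/∂x1) − (∂I1/∂X2)(∂I2/∂x2) = 0, where the partial derivatives are the ordinary partial derivatives of these polynomial functions. -/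
/-- The invariant `I1` of the P = 3 reduction. -/
noncomputable def inv1 (x1 x2 X1 X2 : ℝ) : ℝ :=
  x1 * X1 - 2 * x1 * X2 + 2 * x2 * X1 - x2 * X2

/-- The invariant `I2` of the P = 3 reduction (with parameter `s`). -/
noncomputable def inv2 (s x1 x2 X1 X2 : ℝ) : ℝ :=
  (1 - (3 / 4) * s ^ 2) * (x1 ^ 2 + x1 * x2 + x2 ^ 2)
    + X1 ^ 2 - X1 * X2 + X2 ^ 2

/-- The derivative of a real function given by a quadratic polynomial. -/
theorem deriv_eq_of_eq_quadratic {f : ℝ → ℝ} (a b c x : ℝ)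
    (hf : ∀ t, f t = a * t ^ 2 + b * t + c) : deriv f x = 2 * a * x + b := by
  have h : HasDerivAt (fun t : ℝ => a * t ^ 2 + b * t + c)
      (a * (2 * x) + b * 1) x := by
    have h2 : HasDerivAt (fun t : ℝ => t ^ 2) (2 * x) x := by
      simpa using hasDerivAt_pow 2 x
    exact ((h2.const_mul a).add ((hasDerivAt_id' x).const_mul b)).add_const c
  rw [funext hf]
  rw [h.deriv]
  ring

/-- `I1` and `I2` are in involution with respect to the canonical Poisson
bracket, the partial derivatives being the ordinary derivatives of the
corresponding one-variable sections. -/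
theorem invariants_in_involution (s : ℝ) :
    ∀ x1 x2 X1 X2 : ℝ,
      deriv (fun t => inv1 t x2 X1 X2) x1 * deriv (fun t => inv2 s x1 x2 t X2) X1
        + deriv (fun t => inv1 x1 t X1 X2) x2 * deriv (fun t => inv2 s x1 x2 X1 t) X2
        - deriv (fun t => inv1 x1 x2 t X2) X1 * deriv (fun t => inv2 s t x2 X1 X2) x1
        - deriv (fun t => inv1 x1 x2 X1 t) X2 * deriv (fun t => inv2 s x1 t X1 X2) x2
        = 0 := by
  intro x1 x2 X1 X2
  rw [deriv_eq_of_eq_quadratic (f := fun t => inv1 t x2 X1 X2)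
      0 (X1 - 2 * X2) (2 * x2 * X1 - x2 * X2) x1
      (fun t => by simp only [inv1]; ring),
    deriv_eq_of_eq_quadratic (f := fun t => inv2 s x1 x2 t X2)
      1 (-X2) ((1 - (3 / 4) * s ^ 2) * (x1 ^ 2 + x1 * x2 + x2 ^ 2) + X2 ^ 2) X1
      (fun t => by simp only [inv2]; ring),
    deriv_eq_of_eq_quadratic (f := fun t => inv1 x1 t X1 X2)
      0 (2 * X1 - X2) (x1 * X1 - 2 * x1 * X2) x2
      (fun t => by simp only [inv1]; ring),
    deriv_eq_of_eq_quadratic (f := fun t => inv2 s x1 x2 X1 t)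
      1 (-X1) ((1 - (3 / 4) * s ^ 2) * (x1 ^ 2 + x1 * x2 + x2 ^ 2) + X1 ^ 2) X2
      (fun t => by simp only [inv2]; ring),
    deriv_eq_of_eq_quadratic (f := fun t => inv1 x1 x2 t X2)
      0 (x1 + 2 * x2) (-2 * x1 * X2 - x2 * X2) X1
      (fun t => by simp only [inv1]; ring),
    deriv_eq_of_eq_quadratic (f := fun t => inv2 s t x2 X1 X2)
      (1 - (3 / 4) * s ^ 2) ((1 - (3 / 4) * s ^ 2) * x2)
      ((1 - (3 / 4) * s ^ 2) * x2 ^ 2 + X1 ^ 2 - X1 * X2 + X2 ^ 2) x1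
      (fun t => by simp only [inv2]; ring),
    deriv_eq_of_eq_quadratic (f := fun t => inv1 x1 x2 X1 t)
      0 (-2 * x1 - x2) (x1 * X1 + 2 * x2 * X1) X2
      (fun t => by simp only [inv1]; ring),
    deriv_eq_of_eq_quadratic (f := fun t => inv2 s x1 t X1 X2)
      (1 - (3 / 4) * s ^ 2) ((1 - (3 / 4) * s ^ 2) * x1)
      ((1 - (3 / 4) * s ^ 2) * x1 ^ 2 + X1 ^ 2 - X1 * X2 + X2 ^ 2) x2
      (fun t => by simp only [inv2]; ring)]
  ring
end

section
/- Let P > 0, q > 0, Q := q², and let μ be a real with cos μ = −(P−Q)/(P+Q) and sin μ = 2q√P/(P+Q). Let N ≥ 1 be a natural number with sin(μN) ≠ 0, and let x0, xN be reals. Define the classical path x_n := (xN·sin(μn) + x0·sin(μ(N−n)))/sin(μN) for 0 ≤ n ≤ N. Then the discrete action along this path evaluates to: Σ_{n=0}^{N−1} [ ((P+Q)/q)·x_n·x_{n+1} + ((P−Q)/(2q))·(x_n² + x_{n+1}²) ] = (√P / sin(μN)) · ( 2·x0·xN − (x0² + xN²)·cos(μN) ). -/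
/-- The discrete action of the discrete harmonic oscillator, evaluated along
the classical path interpolating `x0` and `xN`, equals
`(√P/sin(μN))·(2 x0 xN − (x0² + xN²) cos(μN))`. -/
theorem classical_action_discrete_harmonic_oscillator
    (P q Q : ℝ) (hP : 0 < P) (hq : 0 < q) (hQ : Q = q ^ 2)
    (μ : ℝ)
    (hcos : Real.cos μ = -((P - Q) / (P + Q)))
    (hsin : Real.sin μ = 2 * q * Real.sqrt P / (P + Q))
    (N : ℕ) (hN : 1 ≤ N) (hsinN : Real.sin (μ * N) ≠ 0)
    (x0 xN : ℝ) (x : ℕ → ℝ)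
    (hx : ∀ n : ℕ, x n = (xN * Real.sin (μ * n)
        + x0 * Real.sin (μ * ((N : ℝ) - n))) / Real.sin (μ * N)) :
    ∑ n ∈ Finset.range N,
        ((P + Q) / q * x n * x (n + 1)
          + (P - Q) / (2 * q) * (x n ^ 2 + x (n + 1) ^ 2))
      = Real.sqrt P / Real.sin (μ * N) *
          (2 * x0 * xN - (x0 ^ 2 + xN ^ 2) * Real.cos (μ * N)) := by
  have hPQ : 0 < P + Q := by rw [hQ]; positivity
  set c := Real.cos μ
  set s := Real.sin μ
  have hKs : (P + Q) / q * s = 2 * Real.sqrt P := by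
    rw [hsin]; field_simp
  have hKc : (P - Q) / (2 * q) = -((P + Q) / q * c) / 2 := by
    rw [hcos]; field_simp
  obtain ⟨v, hv⟩ : ∃ v : ℕ → ℝ, ∀ n, v n = (xN * Real.cos (μ * n)
      - x0 * Real.cos (μ * ((N : ℝ) - n))) / Real.sin (μ * N) := ⟨_, fun _ => rfl⟩
  have hposition : ∀ n, x (n + 1) = c * x n + s * v n := by
    intro n
    have h₁ : μ * ((n + 1 : ℕ) : ℝ) = μ * n + μ := by push_cast; ring
    have h₂ : μ * ((N : ℝ) - (n + 1 : ℕ)) = μ * ((N : ℝ) - n) - μ := by push_cast; ring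
    rw [hx, hx, hv, h₁, h₂, Real.sin_add, Real.sin_sub]
    ring
  have hvelocity : ∀ n, v (n + 1) = c * v n - s * x n := by
    intro n
    have h₁ : μ * ((n + 1 : ℕ) : ℝ) = μ * n + μ := by push_cast; ring
    have h₂ : μ * ((N : ℝ) - (n + 1 : ℕ)) = μ * ((N : ℝ) - n) - μ := by push_cast; ring
    rw [hv, hv, hx, h₁, h₂, Real.cos_add, Real.cos_sub]
    ring
  have hsc : s ^ 2 + c ^ 2 = 1 := Real.sin_sq_add_cos_sq μ
  have hterm : ∀ n, (P + Q) / q * x n * x (n + 1)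
      + (P - Q) / (2 * q) * (x n ^ 2 + x (n + 1) ^ 2)
      = Real.sqrt P * (x n * v n) - Real.sqrt P * (x (n + 1) * v (n + 1)) := by
    intro n
    have hP' : Real.sqrt P = (P + Q) / q * s / 2 := by rw [hKs]; ring
    have hprev : x n = c * x (n + 1) - s * v (n + 1) := by
      rw [hposition, hvelocity]
      linear_combination (-x n) * hsc
    rw [hKc, hP']
    linear_combination (P + Q) / q / 2 * (x n * hposition n + x (n + 1) * hprev)
  have hx0 : x 0 = x0 := by rw [hx]; simp [hsinN]
  have hxN : x N = xN := by rw [hx]; simp [hsinN]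
  rw [Finset.sum_congr rfl fun n _ => hterm n,
    Finset.sum_range_sub' fun n => Real.sqrt P * (x n * v n), hx0, hxN, hv, hv]
  simp only [Nat.cast_zero, mul_zero, sub_zero, sub_self, Real.cos_zero]
  ring
end

section
/- Let μ be a real number with sin μ ≠ 0 and let n ≥ 1. Let M be the n×n real tridiagonal matrix with M_{ii} = cos μ for all i, M_{i,i+1} = M_{i+1,i} = −1/2 for all i, and all other entries 0. Then det M = sin((n+1)μ) / (2ⁿ · sin μ). -/
/-- The `n × n` symmetric tridiagonal Toeplitz matrix with diagonal entries `a` and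
off-diagonal entries `b`. -/
def tridiagonalToeplitz {R : Type*} [Zero R] (a b : R) (n : ℕ) : Matrix (Fin n) (Fin n) R :=
  Matrix.of fun i j =>
    if (i : ℕ) = (j : ℕ) then a
    else if (i : ℕ) + 1 = (j : ℕ) ∨ (j : ℕ) + 1 = (i : ℕ) then b
    else 0

theorem tridiagonalToeplitz_submatrix_succ {R : Type*} [Zero R] (a b : R) (n : ℕ) :
    (tridiagonalToeplitz a b (n + 1)).submatrix Fin.succ Fin.succ =
      tridiagonalToeplitz a b n := by
  ext i j
  simp [tridiagonalToeplitz]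

theorem det_tridiagonalToeplitz_add_two {R : Type*} [CommRing R] (a b : R) (n : ℕ) :
    (tridiagonalToeplitz a b (n + 2)).det =
      a * (tridiagonalToeplitz a b (n + 1)).det -
        b ^ 2 * (tridiagonalToeplitz a b n).det := by
  have minor : ((tridiagonalToeplitz a b (n + 2)).submatrix Fin.succ
      (Fin.succAbove 1)).det = b * (tridiagonalToeplitz a b n).det := by
    have corner : ((tridiagonalToeplitz a b (n + 2)).submatrix Fin.succ
        (Fin.succAbove 1)).submatrix Fin.succ Fin.succ = tridiagonalToeplitz a b n := by
      ext i j
      have hj : Fin.succAbove (1 : Fin (n + 2)) j.succ = j.succ.succ := by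
        rw [← Fin.succ_zero_eq_one, Fin.succ_succAbove_succ, Fin.succAbove_zero]
      simp [tridiagonalToeplitz, hj]
    rw [Matrix.det_succ_column_zero, Fin.sum_univ_succ, Finset.sum_eq_zero]
    · simp only [Fin.succAbove_zero, corner]
      simp [tridiagonalToeplitz]
    · intro i _
      simp [tridiagonalToeplitz]
  rw [Matrix.det_succ_row_zero, Fin.sum_univ_succ, Fin.sum_univ_succ, Finset.sum_eq_zero]
  · simp only [Fin.succAbove_zero, tridiagonalToeplitz_submatrix_succ, Fin.succ_zero_eq_one,
      minor]
    simp [tridiagonalToeplitz]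
    ring
  · intro i _
    simp [tridiagonalToeplitz]

theorem two_pow_mul_sin_mul_det_tridiagonalToeplitz (μ : ℝ) (n : ℕ) :
    2 ^ n * Real.sin μ * (tridiagonalToeplitz (Real.cos μ) (-(1 / 2)) n).det =
      Real.sin (((n : ℝ) + 1) * μ) := by
  induction n using Nat.twoStepInduction with
  | zero => simp
  | one =>
    norm_num [tridiagonalToeplitz, Real.sin_two_mul]
  | more n ih₀ ih₁ =>
    have sin_recurrence : Real.sin ((((n + 2 : ℕ) : ℝ) + 1) * μ) =
        2 * Real.cos μ * Real.sin ((((n + 1 : ℕ) : ℝ) + 1) * μ) -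
          Real.sin (((n : ℝ) + 1) * μ) := by
      rw [show (((n + 2 : ℕ) : ℝ) + 1) * μ = (((n + 1 : ℕ) : ℝ) + 1) * μ + μ by
          push_cast; ring,
        show ((n : ℝ) + 1) * μ = (((n + 1 : ℕ) : ℝ) + 1) * μ - μ by push_cast; ring,
        Real.sin_add, Real.sin_sub]
      ring
    rw [sin_recurrence, ← ih₀, ← ih₁, det_tridiagonalToeplitz_add_two]
    ring

/-- Determinant of the `n×n` tridiagonal matrix with diagonal `cos μ` and
off-diagonal entries `−1/2`: `det M = sin((n+1)μ)/(2ⁿ sin μ)`. -/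
theorem tridiagonal_determinant
    (μ : ℝ) (hμ : Real.sin μ ≠ 0) (n : ℕ) (hn : 1 ≤ n)
    (M : Matrix (Fin n) (Fin n) ℝ)
    (hM : ∀ i j : Fin n, M i j =
      if (i : ℕ) = (j : ℕ) then Real.cos μ
      else if (i : ℕ) + 1 = (j : ℕ) ∨ (j : ℕ) + 1 = (i : ℕ) then -(1 / 2)
      else 0) :
    M.det = Real.sin (((n : ℝ) + 1) * μ) / (2 ^ n * Real.sin μ) := by
  have hM_eq : M = tridiagonalToeplitz (Real.cos μ) (-(1 / 2)) n := Matrix.ext hM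
  rw [hM_eq, eq_div_iff (mul_ne_zero (by positivity) hμ), mul_comm]
  exact two_pow_mul_sin_mul_det_tridiagonalToeplitz μ n
end

section
/- Let ħ > 0, P real, q > 0, r > 0, Q := q², R := r², and assume (P−Q)/q + (P−R)/r ≠ 0. Define ℒ_b(x,y) := (1/q)((P+Q)xy + (1/2)(P−Q)(x²+y²)) and ℒ_a(x,y) := (1/r)((P+R)xy + (1/2)(P−R)(x²+y²)). Then for all reals x, z there exists a complex number L such that both T ↦ ∫_{−T}^{T} exp((i/ħ)·(ℒ_b(x,v) + ℒ_a(v,z))) dv and T ↦ ∫_{−T}^{T} exp((i/ħ)·(ℒ_a(x,v) + ℒ_b(v,z))) dv converge to L as T → ∞. In other words, the one-step-hat-then-one-step-bar propagator equals the one-step-bar-then-one-step-hat propagator: K_⌟(x,z) = K_⌜(x,z). -/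
open Filter intervalIntegral

/-- The Fresnel integral `∫ s in 0..t, exp (i a s ^ 2)` converges as `t → ∞`. -/
theorem exists_tendsto_fresnel_integral {a : ℝ} (ha : a ≠ 0) :
    ∃ l : ℂ, Tendsto (fun t : ℝ => ∫ s in (0 : ℝ)..t, Complex.exp (Complex.I * a * (s : ℂ) ^ 2))
      atTop (nhds l) := by
  have haC : (a : ℂ) ≠ 0 := Complex.ofReal_ne_zero.mpr ha
  have hcont : Continuous fun s : ℝ => Complex.exp (Complex.I * a * (s : ℂ) ^ 2) := by fun_prop
  have hnorm : ∀ s : ℝ, ‖Complex.exp (Complex.I * a * (s : ℂ) ^ 2)‖ = 1 := fun s => by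
    rw [show Complex.I * a * (s : ℂ) ^ 2 = ((a * s ^ 2 : ℝ) : ℂ) * Complex.I by push_cast; ring]
    exact Complex.norm_exp_ofReal_mul_I _
  let k : ℂ := (2 * Complex.I * a)⁻¹
  let G : ℝ → ℂ := fun s => k * ((s : ℂ)⁻¹ * Complex.exp (Complex.I * a * (s : ℂ) ^ 2))
  let R : ℝ → ℂ := fun s => k * (((s : ℂ) ^ 2)⁻¹ * Complex.exp (Complex.I * a * (s : ℂ) ^ 2))
  have hG : ∀ s : ℝ, s ≠ 0 →
      HasDerivAt G (Complex.exp (Complex.I * a * (s : ℂ) ^ 2) - R s) s := fun s hs => by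
    have hsC : (s : ℂ) ≠ 0 := Complex.ofReal_ne_zero.mpr hs
    have h := (((hasDerivAt_inv hsC).mul
      (((hasDerivAt_pow 2 (s : ℂ)).const_mul (Complex.I * a)).cexp)).const_mul k).comp_ofReal
    refine h.congr_deriv ?_
    simp only [R, k]
    field_simp
    push_cast
    ring
  have hRc : ContinuousOn R {0}ᶜ := by
    refine continuousOn_const.mul (ContinuousOn.mul (ContinuousOn.inv₀ (by fun_prop) ?_)
      hcont.continuousOn)
    intro s hs
    exact pow_ne_zero 2 (Complex.ofReal_ne_zero.mpr hs)
  have hRi : MeasureTheory.IntegrableOn R (Set.Ioi 1) := by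
    have h := (integrableOn_Ioi_rpow_of_lt (by norm_num : (-2 : ℝ) < -1) one_pos).const_mul ‖k‖
    refine h.mono' ((hRc.mono ?_).aestronglyMeasurable measurableSet_Ioi) ?_
    · intro s hs
      exact (zero_lt_one.trans hs).ne'
    · filter_upwards [MeasureTheory.ae_restrict_mem measurableSet_Ioi] with s hs
      have hs0 : (0 : ℝ) < s := zero_lt_one.trans hs
      simp only [R, norm_mul, hnorm, mul_one, norm_inv, norm_pow, Complex.norm_real,
        Real.norm_eq_abs, sq_abs]
      rw [Real.rpow_neg hs0.le, Real.rpow_two]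
  have hGlim : Tendsto G atTop (nhds 0) := by
    rw [tendsto_zero_iff_norm_tendsto_zero]
    have h : Tendsto (fun s : ℝ => ‖k‖ * |s|⁻¹) atTop (nhds (‖k‖ * 0)) :=
      (tendsto_inv_atTop_zero.comp tendsto_abs_atTop_atTop).const_mul _
    simpa [G, norm_mul, hnorm] using h
  have hRlim := MeasureTheory.intervalIntegral_tendsto_integral_Ioi 1 hRi tendsto_id
  refine ⟨_, ((tendsto_const_nhds (x := ∫ s in (0 : ℝ)..1,
    Complex.exp (Complex.I * a * (s : ℂ) ^ 2))).add
    ((hGlim.sub_const (G 1)).add hRlim)).congr' ?_⟩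
  filter_upwards [eventually_ge_atTop 1] with t ht
  have hne : Set.uIcc 1 t ⊆ {0}ᶜ := fun s hs => by
    rw [Set.uIcc_of_le ht] at hs
    exact (zero_lt_one.trans_le hs.1).ne'
  have hRt : IntervalIntegrable R MeasureTheory.volume 1 t := (hRc.mono hne).intervalIntegrable
  have hFTC := integral_eq_sub_of_hasDerivAt (fun s hs => hG s (hne hs))
    ((hcont.intervalIntegrable 1 t).sub hRt)
  rw [integral_sub (hcont.intervalIntegrable 1 t) hRt] at hFTC
  rw [← integral_add_adjacent_intervals (hcont.intervalIntegrable 0 1)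
    (hcont.intervalIntegrable 1 t), ← hFTC, id, sub_add_cancel]

/-- The symmetric improper integral of `exp (i a (v + c) ^ 2)` does not depend on the shift `c`. -/
theorem exists_tendsto_shifted_fresnel_integral {a : ℝ} (ha : a ≠ 0) :
    ∃ l : ℂ, ∀ c : ℝ, Tendsto (fun T : ℝ => ∫ v in (-T)..T,
      Complex.exp (Complex.I * a * ((v + c : ℝ) : ℂ) ^ 2)) atTop (nhds l) := by
  obtain ⟨l, hl⟩ := exists_tendsto_fresnel_integral ha
  refine ⟨l + l, fun c => ?_⟩
  have hcont : Continuous fun s : ℝ => Complex.exp (Complex.I * a * (s : ℂ) ^ 2) := by fun_prop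
  refine ((hl.comp (tendsto_atTop_add_const_right _ (-c) tendsto_id)).add
    (hl.comp (tendsto_atTop_add_const_right _ c tendsto_id))).congr fun T => ?_
  have hodd := integral_comp_neg (a := 0) (b := T + -c)
    fun s : ℝ => Complex.exp (Complex.I * a * (s : ℂ) ^ 2)
  simp only [Complex.ofReal_neg, neg_sq, neg_zero, neg_add, neg_neg] at hodd
  simp only [Function.comp_apply, id]
  rw [integral_comp_add_right (fun s : ℝ => Complex.exp (Complex.I * a * (s : ℂ) ^ 2)), hodd]
  exact integral_add_adjacent_intervals (hcont.intervalIntegrable _ _)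
    (hcont.intervalIntegrable _ _)

/-- Path independence of the two-step propagator: the hat-then-bar and
bar-then-hat one-step propagators, defined as improper (Fresnel-type)
oscillatory integrals over the intermediate variable, converge to the same
complex number. -/
theorem corner_propagators_equal
    (hbar P q r Q R : ℝ) (hhbar : 0 < hbar) (hq : 0 < q) (hr : 0 < r)
    (hQ : Q = q ^ 2) (hR : R = r ^ 2)
    (hne : (P - Q) / q + (P - R) / r ≠ 0)
    (Lb La : ℝ → ℝ → ℝ)
    (hLb : ∀ x y, Lb x y = (1 / q) * ((P + Q) * x * y
        + (1 / 2) * (P - Q) * (x ^ 2 + y ^ 2)))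
    (hLa : ∀ x y, La x y = (1 / r) * ((P + R) * x * y
        + (1 / 2) * (P - R) * (x ^ 2 + y ^ 2)))
    (x z : ℝ) :
    ∃ L : ℂ,
      Tendsto (fun T : ℝ => ∫ v in (-T)..T,
          Complex.exp ((Complex.I / (hbar : ℂ)) * ((Lb x v + La v z : ℝ) : ℂ)))
        atTop (nhds L) ∧
      Tendsto (fun T : ℝ => ∫ v in (-T)..T,
          Complex.exp ((Complex.I / (hbar : ℂ)) * ((La x v + Lb v z : ℝ) : ℂ)))
        atTop (nhds L) := by
 
  set A : ℝ := (P - Q) / q + (P - R) / r with hA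
  obtain ⟨l, hl⟩ := exists_tendsto_shifted_fresnel_integral (a := A / (2 * hbar))
    (by positivity)
  set B₁ : ℝ := (P + Q) / q * x + (P + R) / r * z with hB₁
  set B₂ : ℝ := (P + R) / r * x + (P + Q) / q * z with hB₂
  set K : ℝ := (P - Q) / q * x ^ 2 / 2 + (P - R) / r * z ^ 2 / 2 - B₁ ^ 2 / (2 * A) with hK
  have hK' : K = (P - R) / r * x ^ 2 / 2 + (P - Q) / q * z ^ 2 / 2 - B₂ ^ 2 / (2 * A) := by
    have hBB : B₁ ^ 2 - B₂ ^ 2 = A * ((P - Q) / q - (P - R) / r) * (x ^ 2 - z ^ 2) := by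
      rw [hB₁, hB₂, hA, hQ, hR]
      field_simp
      ring
    have h : B₁ ^ 2 / (2 * A) = B₂ ^ 2 / (2 * A)
        + ((P - Q) / q - (P - R) / r) * (x ^ 2 - z ^ 2) / 2 := by
      rw [eq_add_of_sub_eq hBB]
      field_simp
      ring
    rw [hK, h]
    ring
  have hcomplete : ∀ B v : ℝ,
      A / 2 * (v + B / A) ^ 2 = A / 2 * v ^ 2 + B * v + B ^ 2 / (2 * A) := fun B v => by
    field_simp
    ring
  have hsquare : ∀ S B v : ℝ, S = A / 2 * (v + B / A) ^ 2 + K →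
      Complex.exp (Complex.I / hbar * (S : ℂ)) = Complex.exp (Complex.I / hbar * K) *
        Complex.exp (Complex.I * ((A / (2 * hbar) : ℝ) : ℂ) * ((v + B / A : ℝ) : ℂ) ^ 2) := by
    intro S B v hS
    rw [← Complex.exp_add, hS, Complex.ofReal_add, Complex.ofReal_mul, Complex.ofReal_pow]
    congr 1
    push_cast
    ring
  refine ⟨Complex.exp (Complex.I / hbar * K) * l,
    ((hl (B₁ / A)).const_mul _).congr fun T => ?_, ((hl (B₂ / A)).const_mul _).congr fun T => ?_⟩
  · rw [← integral_const_mul]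
    refine integral_congr fun v _ => (hsquare _ B₁ v ?_).symm
    rw [hLb, hLa, hK, hcomplete, hB₁, hA]
    ring
  · rw [← integral_const_mul]
    refine integral_congr fun v _ => (hsquare _ B₂ v ?_).symm
    rw [hLb, hLa, hK', hcomplete, hB₂, hA]
    ring
end

section
/- Let P > 0, q > 0, r > 0, Q := q², R := r². Define ℒ_b(x,y) := (1/q)((P+Q)xy + (1/2)(P−Q)(x²+y²)) and ℒ_a(x,y) := (1/r)((P+R)xy + (1/2)(P−R)(x²+y²)). Fix reals x and x̂, and define S : ℝ² → ℝ by S(v,w) := ℒ_a(x,v) + ℒ_b(v,w) − ℒ_a(x̂,w). Then S has a unique critical point (v*,w*), and its critical value equals the one-step Lagrangian: S(v*,w*) = ℒ_b(x,x̂). -/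
/-- The derivative of a quadratic polynomial in two variables. -/
theorem hasFDerivAt_quadratic (c d e l m n : ℝ) (p : ℝ × ℝ) :
    HasFDerivAt (fun p : ℝ × ℝ =>
        c / 2 * p.1 ^ 2 + d * (p.1 * p.2) + e / 2 * p.2 ^ 2 + l * p.1 + m * p.2 + n)
      ((c * p.1 + d * p.2 + l) • ContinuousLinearMap.fst ℝ ℝ ℝ
        + (d * p.1 + e * p.2 + m) • ContinuousLinearMap.snd ℝ ℝ ℝ) p := by
  have h₁ : HasFDerivAt (fun p : ℝ × ℝ => p.1) (ContinuousLinearMap.fst ℝ ℝ ℝ) p := hasFDerivAt_fst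
  have h₂ : HasFDerivAt (fun p : ℝ × ℝ => p.2) (ContinuousLinearMap.snd ℝ ℝ ℝ) p := hasFDerivAt_snd
  refine (((((((h₁.pow 2).const_mul (c / 2)).add ((h₁.mul h₂).const_mul d)).add
    ((h₂.pow 2).const_mul (e / 2))).add (h₁.const_mul l)).add
    (h₂.const_mul m)).add_const n).congr_fderiv ?_
  ext <;> simp <;> ring

/-- The critical points of a quadratic polynomial in two variables are the solutions of a
linear system. -/
theorem fderiv_quadratic_eq_zero_iff (c d e l m n : ℝ) (p : ℝ × ℝ) :
    fderiv ℝ (fun p : ℝ × ℝ =>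
        c / 2 * p.1 ^ 2 + d * (p.1 * p.2) + e / 2 * p.2 ^ 2 + l * p.1 + m * p.2 + n) p = 0 ↔
      c * p.1 + d * p.2 + l = 0 ∧ d * p.1 + e * p.2 + m = 0 := by
  rw [(hasFDerivAt_quadratic c d e l m n p).fderiv]
  constructor
  · intro h
    exact ⟨by simpa using DFunLike.congr_fun h (1, 0), by simpa using DFunLike.congr_fun h (0, 1)⟩
  · rintro ⟨h₁, h₂⟩
    simp [h₁, h₂]

/-- Quantum closure for the ⊓-shaped time path: the quadratic action
`S(v,w) = ℒ_a(x,v) + ℒ_b(v,w) − ℒ_a(x̂,w)` has a unique critical point, and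
its critical value equals the one-step Lagrangian `ℒ_b(x,x̂)`. -/
theorem sqcap_action_critical_value
    (P q r Q R : ℝ) (hP : 0 < P) (hq : 0 < q) (hr : 0 < r)
    (hQ : Q = q ^ 2) (hR : R = r ^ 2)
    (Lb La : ℝ → ℝ → ℝ)
    (hLb : ∀ x y, Lb x y = (1 / q) * ((P + Q) * x * y
        + (1 / 2) * (P - Q) * (x ^ 2 + y ^ 2)))
    (hLa : ∀ x y, La x y = (1 / r) * ((P + R) * x * y
        + (1 / 2) * (P - R) * (x ^ 2 + y ^ 2)))
    (x xh : ℝ)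
    (S : ℝ × ℝ → ℝ)
    (hS : ∀ p : ℝ × ℝ, S p = La x p.1 + Lb p.1 p.2 - La xh p.2) :
    (∃! p : ℝ × ℝ, fderiv ℝ S p = 0) ∧
    (∀ p : ℝ × ℝ, fderiv ℝ S p = 0 → S p = Lb x xh) := by
  obtain ⟨a, ha⟩ : ∃ a, a = (P + R) / r := ⟨_, rfl⟩
  obtain ⟨A, hA⟩ : ∃ A, A = (P - R) / r := ⟨_, rfl⟩
  obtain ⟨b, hb⟩ : ∃ b, b = (P + Q) / q := ⟨_, rfl⟩
  obtain ⟨B, hB⟩ : ∃ B, B = (P - Q) / q := ⟨_, rfl⟩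
  have ha0 : a ≠ 0 := by
    subst hR
    rw [ha]
    positivity
  have hdisc : a ^ 2 - A ^ 2 = b ^ 2 - B ^ 2 := by
    rw [ha, hA, hb, hB, hQ, hR]
    field_simp
    ring
  have hS' : S = fun p : ℝ × ℝ => (A + B) / 2 * p.1 ^ 2 + b * (p.1 * p.2)
      + (B - A) / 2 * p.2 ^ 2 + (a * x) * p.1 + (-(a * xh)) * p.2
      + A / 2 * (x ^ 2 - xh ^ 2) := by
    funext p
    rw [hS, hLa, hLb, hLa, ha, hA, hb, hB]
    ring
  have hcrit : ∀ p : ℝ × ℝ, fderiv ℝ S p = 0 ↔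
      p = (((B - A) * x + b * xh) / a, -((A + B) * xh + b * x) / a) := by
    intro p
    rw [hS', fderiv_quadratic_eq_zero_iff, Prod.ext_iff, eq_div_iff ha0, eq_div_iff ha0]
    constructor
    · rintro ⟨h₁, h₂⟩
      constructor <;> apply mul_left_cancel₀ ha0
      · linear_combination p.1 * hdisc - (B - A) * h₁ + b * h₂
      · linear_combination p.2 * hdisc + b * h₁ - (A + B) * h₂
    · rintro ⟨h₁, h₂⟩
      constructor <;> apply mul_left_cancel₀ ha0
      · linear_combination (A + B) * h₁ + b * h₂ + x * hdisc
      · linear_combination b * h₁ + (B - A) * h₂ - xh * hdisc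
  refine ⟨⟨_, (hcrit _).2 rfl, fun p hp => (hcrit p).1 hp⟩, fun p hp => ?_⟩
  have hLb' : Lb x xh = b * x * xh + B / 2 * (x ^ 2 + xh ^ 2) := by
    rw [hLb, hb, hB]
    ring
  have hv := congrArg Prod.fst ((hcrit p).1 hp)
  have hw := congrArg Prod.snd ((hcrit p).1 hp)
  rw [eq_div_iff ha0] at hv hw
  rw [hS', fderiv_quadratic_eq_zero_iff] at hp
  rw [hLb', hS']
  linear_combination p.1 / 2 * hp.1 + p.2 / 2 * hp.2 + x / 2 * hv - xh / 2 * hw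
end

section
/- Let α, β, a, b, a0, b0 be reals with α ≠ 0, β ≠ 0, and set D1 := β·b0 + α·(a−a0) and D2 := α·a0 + β·(b−b0); assume D1 ≠ 0 and D2 ≠ 0. Suppose the three path-independence conditions hold: (1) β(b−b0) − β²/(4·D1) = α(a−a0) − α²/(4·D2); (2) α·a0 − α²/(4·D1) = β·b0 − β²/(4·D2); (3) αβ/(2·D1) = αβ/(2·D2). Then α·(2a0 − a) = β·(2b0 − b) and α²·(a² − 1) = β²·(b² − 1). -/
/-- The three path-independence conditions on the coefficients of the general
quadratic oscillator Lagrangians force `α(2a0−a) = β(2b0−b)` and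
`α²(a²−1) = β²(b²−1)`. -/
theorem path_independence_conditions_force_coefficients
    (α β a b a0 b0 : ℝ) (hα : α ≠ 0) (hβ : β ≠ 0)
    (D1 D2 : ℝ)
    (hD1 : D1 = β * b0 + α * (a - a0)) (hD2 : D2 = α * a0 + β * (b - b0))
    (hD1ne : D1 ≠ 0) (hD2ne : D2 ≠ 0)
    (h1 : β * (b - b0) - β ^ 2 / (4 * D1) = α * (a - a0) - α ^ 2 / (4 * D2))
    (h2 : α * a0 - α ^ 2 / (4 * D1) = β * b0 - β ^ 2 / (4 * D2))
    (h3 : α * β / (2 * D1) = α * β / (2 * D2)) :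
    α * (2 * a0 - a) = β * (2 * b0 - b) ∧
    α ^ 2 * (a ^ 2 - 1) = β ^ 2 * (b ^ 2 - 1) := by
  have hD : D1 = D2 := by
    field_simp at h3
    linarith
  rw [← hD] at h1 hD2
  refine ⟨by linarith, ?_⟩
  have hsum : α * a + β * b = 2 * D1 := by linarith
  have hdiff : (β * b - α * a) * (2 * D1) = β ^ 2 - α ^ 2 := by
    have hfrac : β * b - α * a = 2 * (β ^ 2 / (4 * D1) - α ^ 2 / (4 * D1)) := by linarith
    rw [hfrac]
    field_simp
    ring
  rw [← hsum] at hdiff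
  linear_combination -hdiff
end

section
/- Let p1, p2, p3 be pairwise distinct reals with p1+p2 ≠ 0, p2+p3 ≠ 0, p3+p1 ≠ 0, and set s12 := (p1+p2)/(p1−p2), s23 := (p2+p3)/(p2−p3), s31 := (p3+p1)/(p3−p1). Then: (i) s12·s23 + s23·s31 + s31·s12 + 1 = 0; and (ii) the 3×3 real matrix A := [[s23+s31, 1, −1], [1, −(s12+s23), s12], [−1, s12, −(s12+s31)]] is singular: det A = 0. -/
/-- (i) The parameter identity `s12 s23 + s23 s31 + s31 s12 + 1 = 0` for
`s_{ij} = (p_i+p_j)/(p_i−p_j)`, and (ii) singularity of the pop-up-cube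
coefficient matrix. -/
theorem parameter_identity_and_singular_matrix
    (p1 p2 p3 : ℝ) (h12 : p1 ≠ p2) (h23 : p2 ≠ p3) (h31 : p3 ≠ p1)
    (h12' : p1 + p2 ≠ 0) (h23' : p2 + p3 ≠ 0) (h31' : p3 + p1 ≠ 0)
    (s12 s23 s31 : ℝ)
    (hs12 : s12 = (p1 + p2) / (p1 - p2))
    (hs23 : s23 = (p2 + p3) / (p2 - p3))
    (hs31 : s31 = (p3 + p1) / (p3 - p1)) :
    s12 * s23 + s23 * s31 + s31 * s12 + 1 = 0 ∧
    Matrix.det !![s23 + s31, 1, -1;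
                  1, -(s12 + s23), s12;
                  -1, s12, -(s12 + s31)] = 0 := by
  have h : s12 * s23 + s23 * s31 + s31 * s12 + 1 = 0 := by
    have d12 := sub_ne_zero.mpr h12
    have d23 := sub_ne_zero.mpr h23
    have d31 := sub_ne_zero.mpr h31
    rw [hs12, hs23, hs31]
    field_simp
    ring
  refine ⟨h, ?_⟩
  simp [Matrix.det_fin_three]
  linear_combination (s23 + s31) * h
end

section
/- Let p1, p2, p3 be pairwise distinct reals with p1+p2 ≠ 0, p2+p3 ≠ 0, p3+p1 ≠ 0, and set s_ij := (p_i+p_j)/(p_i−p_j). Define the lattice Lagrangian ℒ(u,v,w; s) := u(v−w) − (1/2)s(v−w)². Fix reals u, u1, u2, u12, u23 and define S_pop : ℝ² → ℝ by S_pop(u3, u31) := ℒ(u1,u12,u31; s23) + ℒ(u2,u23,u12; s31) + ℒ(u3,u31,u23; s12) − ℒ(u,u2,u3; s23) − ℒ(u,u3,u1; s31). Then S_pop has a unique critical point, and its critical value equals ℒ(u,u1,u2; s12) = u(u1−u2) − (1/2)s12(u1−u2)². In particular the critical value does not depend on u12 or u23. -/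
/-- The critical points of the pop-up-cube action are the solutions of a linear system. -/
theorem fderiv_popup_cube_eq_zero_iff {a b c u u1 u2 u12 u23 : ℝ} {S : ℝ × ℝ → ℝ}
    (hS : ∀ p : ℝ × ℝ, S p =
      latticeL u1 u12 p.2 b + latticeL u2 u23 u12 c
        + latticeL p.1 p.2 u23 a
        - latticeL u u2 p.1 b - latticeL u p.1 u1 c) (p : ℝ × ℝ) :
    fderiv ℝ S p = 0 ↔
      (b + c) * p.1 + p.2 = u23 + b * u2 + c * u1 ∧
        p.1 - (a + b) * p.2 = u1 - b * u12 - a * u23 := by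
  have hfst : HasFDerivAt (fun q : ℝ × ℝ => q.1) (ContinuousLinearMap.fst ℝ ℝ ℝ) p :=
    hasFDerivAt_fst
  have hsnd : HasFDerivAt (fun q : ℝ × ℝ => q.2) (ContinuousLinearMap.snd ℝ ℝ ℝ) p :=
    hasFDerivAt_snd
  have hL {f g h : ℝ × ℝ → ℝ} {f' g' h' : ℝ × ℝ →L[ℝ] ℝ} (s : ℝ)
      (hf : HasFDerivAt f f' p) (hg : HasFDerivAt g g' p) (hh : HasFDerivAt h h' p) :
      HasFDerivAt (fun q => latticeL (f q) (g q) (h q) s)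
        ((g p - h p) • f' + (f p - s * (g p - h p)) • (g' - h')) p := by
    have hd := hg.sub hh
    refine ((hf.mul hd).sub ((hd.pow 2).const_mul ((1 / 2) * s))).congr_fderiv ?_
    ext <;> simp <;> ring
  have hk (k : ℝ) : HasFDerivAt (fun _ : ℝ × ℝ => k) (0 : ℝ × ℝ →L[ℝ] ℝ) p :=
    hasFDerivAt_const k p
  have hD := ((((hL b (hk u1) (hk u12) hsnd).add (hL c (hk u2) (hk u23) (hk u12))).add
    (hL a hfst hsnd (hk u23))).sub (hL b (hk u) (hk u2) hfst)).sub (hL c (hk u) hfst (hk u1))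
  have hSD := hD.congr_of_eventuallyEq (Filter.Eventually.of_forall hS)
  rw [hSD.fderiv]
  constructor
  · intro h
    have hx := DFunLike.congr_fun h ((1 : ℝ), (0 : ℝ))
    have hy := DFunLike.congr_fun h ((0 : ℝ), (1 : ℝ))
    simp at hx hy
    exact ⟨by linear_combination hx, by linear_combination hy⟩
  · rintro ⟨hx, hy⟩
    ext
    · simp
      linear_combination hx
    · simp
      linear_combination hy

/-- The pop-up-cube action has a unique critical point, whose critical value
equals the flat-plaquette Lagrangian `ℒ(u,u1,u2; s12)`; in particular it is
independent of `u12` and `u23`. -/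
theorem popup_cube_critical_value
    (p1 p2 p3 : ℝ) (h12 : p1 ≠ p2) (h23 : p2 ≠ p3) (h31 : p3 ≠ p1)
    (h12' : p1 + p2 ≠ 0) (h23' : p2 + p3 ≠ 0) (h31' : p3 + p1 ≠ 0)
    (s12 s23 s31 : ℝ)
    (hs12 : s12 = (p1 + p2) / (p1 - p2))
    (hs23 : s23 = (p2 + p3) / (p2 - p3))
    (hs31 : s31 = (p3 + p1) / (p3 - p1))
    (u u1 u2 u12 u23 : ℝ)
    (S : ℝ × ℝ → ℝ)
    (hS : ∀ p : ℝ × ℝ, S p =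
      latticeL u1 u12 p.2 s23 + latticeL u2 u23 u12 s31
        + latticeL p.1 p.2 u23 s12
        - latticeL u u2 p.1 s23 - latticeL u p.1 u1 s31) :
    (∃! p : ℝ × ℝ, fderiv ℝ S p = 0) ∧
    (∀ p : ℝ × ℝ, fderiv ℝ S p = 0 →
      S p = u * (u1 - u2) - (1 / 2) * s12 * (u1 - u2) ^ 2) := by
  have hstar : s12 * s23 + s23 * s31 + s31 * s12 = -1 := by
    have := sub_ne_zero.mpr h12
    have := sub_ne_zero.mpr h23
    have := sub_ne_zero.mpr h31
    rw [hs12, hs23, hs31]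
    field_simp
    ring
  have hb : s23 ≠ 0 := hs23 ▸ div_ne_zero h23' (sub_ne_zero.mpr h23)
  have hcrit := fderiv_popup_cube_eq_zero_iff hS
  have hsolve (p : ℝ × ℝ) (hp : fderiv ℝ S p = 0) :
      s23 ^ 2 * p.1 = (s12 + s23) * (u23 + s23 * u2 + s31 * u1)
          + (u1 - s23 * u12 - s12 * u23) ∧
        s23 ^ 2 * p.2 = (u23 + s23 * u2 + s31 * u1)
          - (s23 + s31) * (u1 - s23 * u12 - s12 * u23) := by
    obtain ⟨hx, hy⟩ := (hcrit p).1 hp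
    constructor
    · linear_combination (s12 + s23) * hx + hy - p.1 * hstar
    · linear_combination hx - (s23 + s31) * hy - p.2 * hstar
  refine ⟨⟨(((s12 + s23) * (u23 + s23 * u2 + s31 * u1)
          + (u1 - s23 * u12 - s12 * u23)) / s23 ^ 2,
        ((u23 + s23 * u2 + s31 * u1)
          - (s23 + s31) * (u1 - s23 * u12 - s12 * u23)) / s23 ^ 2), ?_, ?_⟩, ?_⟩
  · refine (hcrit _).2 ⟨?_, ?_⟩
    · field_simp
      linear_combination (u23 + s23 * u2 + s31 * u1) * hstar
    · field_simp
      linear_combination (u1 - s23 * u12 - s12 * u23) * hstar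
  · intro p hp
    obtain ⟨hx, hy⟩ := hsolve p hp
    ext
    · rw [eq_div_iff (pow_ne_zero 2 hb), mul_comm, hx]
    · rw [eq_div_iff (pow_ne_zero 2 hb), mul_comm, hy]
  · intro p hp
    obtain ⟨hx, hy⟩ := (hcrit p).1 hp
    obtain ⟨hX, hY⟩ := hsolve p hp
    rw [hS]
    unfold latticeL
    apply mul_left_cancel₀ (pow_ne_zero 2 hb)
    linear_combination s23 ^ 2 * (p.1 / 2 * hx + p.2 / 2 * hy)
      - (u23 + s23 * u2 + s31 * u1) / 2 * hX
      - (u1 - s23 * u12 - s12 * u23) / 2 * hY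
      + ((s23 - s31) / 2 * u1 ^ 2 + (s12 - s23) / 2 * u23 ^ 2 + s23 * u12 * u23
        - s23 * u1 * u2 - u1 * u23) * hstar
end

section
/- Let p1, p2, p3 be pairwise distinct reals with p1+p2 ≠ 0, p2+p3 ≠ 0, p3+p1 ≠ 0, and set s12 := (p1+p2)/(p1−p2), s23 := (p2+p3)/(p2−p3), s31 := (p3+p1)/(p3−p1). Fix reals u_i, u_j, u_k and define S : ℝ³ → ℝ by S(u_ij, u_jk, u_ki) := u_k(u_ki − u_jk) − (1/2)s12(u_ki − u_jk)² + u_i(u_ij − u_ki) − (1/2)s23(u_ij − u_ki)² + u_j(u_jk − u_ij) − (1/2)s31(u_jk − u_ij)². Then the set of critical points of S is nonempty, and at every critical point the value of S equals −(1/2)·[ s12(u_i − u_j)² + s23(u_j − u_k)² + s31(u_k − u_i)² ], which is precisely the value, for every real u, of the action of the opposite configuration ℒ(u,u_i,u_j; s12) + ℒ(u,u_j,u_k; s23) + ℒ(u,u_k,u_i; s31), where ℒ(u,v,w; s) := u(v−w) − (1/2)s(v−w)². -/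
/-- The derivative of `x ↦ u ℓ(x) - (1/2) s ℓ(x)²` for a continuous linear form `ℓ`. -/
theorem hasFDerivAt_linear_sub_half_sq {E : Type*} [NormedAddCommGroup E] [NormedSpace ℝ E]
    (l : E →L[ℝ] ℝ) (u s : ℝ) (x : E) :
    HasFDerivAt (fun y => u * l y - (1 / 2) * s * l y ^ 2) ((u - s * l x) • l) x := by
  have hl := l.hasFDerivAt (x := x)
  refine ((hl.const_mul u).sub ((hl.pow 2).const_mul ((1 / 2) * s))).congr_fderiv ?_
  ext v
  simp
  ring

/-- The star-triangle relation for the coefficients `(p + q) / (p - q)`. -/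
theorem sum_mul_add_div_sub_eq_neg_one {p q r : ℝ} (hpq : p ≠ q) (hqr : q ≠ r) (hrp : r ≠ p) :
    (p + q) / (p - q) * ((q + r) / (q - r)) + (q + r) / (q - r) * ((r + p) / (r - p))
      + (r + p) / (r - p) * ((p + q) / (p - q)) = -1 := by
  have h1 := sub_ne_zero.mpr hpq
  have h2 := sub_ne_zero.mpr hqr
  have h3 := sub_ne_zero.mpr hrp
  field_simp
  ring

/-- Elementary move (a): the action of configuration (ii) (three opposite
plaquettes of the cube, variables `u_ij, u_jk, u_ki`) has critical points,
at each of which its value equals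
`−(1/2)[s12(u_i−u_j)² + s23(u_j−u_k)² + s31(u_k−u_i)²]`, which is also the
value of the action of configuration (i) for every `u`. -/
theorem elementary_move_a_contributions_agree
    (p1 p2 p3 : ℝ) (h12 : p1 ≠ p2) (h23 : p2 ≠ p3) (h31 : p3 ≠ p1)
    (h12' : p1 + p2 ≠ 0) (h23' : p2 + p3 ≠ 0) (h31' : p3 + p1 ≠ 0)
    (s12 s23 s31 : ℝ)
    (hs12 : s12 = (p1 + p2) / (p1 - p2))
    (hs23 : s23 = (p2 + p3) / (p2 - p3))
    (hs31 : s31 = (p3 + p1) / (p3 - p1))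
    (ui uj uk : ℝ)
    (S : ℝ × ℝ × ℝ → ℝ)
    (hS : ∀ p : ℝ × ℝ × ℝ, S p =
      uk * (p.2.2 - p.2.1) - (1 / 2) * s12 * (p.2.2 - p.2.1) ^ 2
        + ui * (p.1 - p.2.2) - (1 / 2) * s23 * (p.1 - p.2.2) ^ 2
        + uj * (p.2.1 - p.1) - (1 / 2) * s31 * (p.2.1 - p.1) ^ 2) :
    (∃ p : ℝ × ℝ × ℝ, fderiv ℝ S p = 0) ∧
    (∀ p : ℝ × ℝ × ℝ, fderiv ℝ S p = 0 →
      S p = -(1 / 2) * (s12 * (ui - uj) ^ 2 + s23 * (uj - uk) ^ 2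
        + s31 * (uk - ui) ^ 2)) ∧
    (∀ u : ℝ,
      latticeL u ui uj s12 + latticeL u uj uk s23 + latticeL u uk ui s31
        = -(1 / 2) * (s12 * (ui - uj) ^ 2 + s23 * (uj - uk) ^ 2
            + s31 * (uk - ui) ^ 2)) := by
  have hrel : s12 * s23 + s23 * s31 + s31 * s12 = -1 := by
    rw [hs12, hs23, hs31]
    exact sum_mul_add_div_sub_eq_neg_one h12 h23 h31
  let x : ℝ × ℝ × ℝ →L[ℝ] ℝ := .fst ℝ ℝ (ℝ × ℝ)
  let y : ℝ × ℝ × ℝ →L[ℝ] ℝ := (ContinuousLinearMap.fst ℝ ℝ ℝ).comp (.snd ℝ ℝ (ℝ × ℝ))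
  let z : ℝ × ℝ × ℝ →L[ℝ] ℝ := (ContinuousLinearMap.snd ℝ ℝ ℝ).comp (.snd ℝ ℝ (ℝ × ℝ))
  have hderiv (p : ℝ × ℝ × ℝ) : fderiv ℝ S p =
      (uk - s12 * (p.2.2 - p.2.1)) • (z - y) + (ui - s23 * (p.1 - p.2.2)) • (x - z)
        + (uj - s31 * (p.2.1 - p.1)) • (y - x) := by
    have h := ((hasFDerivAt_linear_sub_half_sq (z - y) uk s12 p).add
      (hasFDerivAt_linear_sub_half_sq (x - z) ui s23 p)).add
      (hasFDerivAt_linear_sub_half_sq (y - x) uj s31 p)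
    refine (h.congr_of_eventuallyEq (.of_forall fun q => ?_)).fderiv
    simp only [hS, Pi.add_apply, sub_apply, x, y, z, ContinuousLinearMap.comp_apply,
      ContinuousLinearMap.coe_fst', ContinuousLinearMap.coe_snd']
    ring
  refine ⟨⟨(0, s23 * (uk - uj) + s12 * (ui - uj), s12 * (ui - uj) + s31 * (ui - uk)), ?_⟩,
    fun p hp => ?_, fun u => ?_⟩
  · rw [hderiv]
    ext <;> simp [x, y, z]
    · linear_combination (ui - uj) * hrel
    · linear_combination (uj - uk) * hrel
    · linear_combination (uk - ui) * hrel
  · rw [hderiv] at hp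
    have e1 := DFunLike.congr_fun hp (1, 0, 0)
    have e2 := DFunLike.congr_fun hp (0, 1, 0)
    obtain ⟨a, b, c⟩ := p
    simp [x, y, z] at e1 e2
    have hA : c - b = s31 * (ui - uk) + s23 * (uj - uk) := by
      linear_combination (c - b) * hrel - s31 * e1 - (s31 + s23) * e2
    have hB : a - c = s12 * (uj - ui) + s31 * (uk - ui) := by
      linear_combination (a - c) * hrel + (s12 + s31) * e1 + s31 * e2
    rw [hS]
    linear_combination (1 / 2) * ((a - c) * e1 - (c - b) * e2 + (uk - uj) * hA + (ui - uj) * hB)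
  · simp only [latticeL]
    ring
end
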